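/- arXiv:1601.02972 — 2 statements merged into one kernel-verified Lean document; each statement's English description precedes it below -/
import Mathlib

section
/- The function s ↦ s · θ₄'(s)/θ₄(s) is strictly decreasing on the positive real half-line (0, ∞). -/
noncomputable def theta4 (s : ℝ) : ℝ := ∑' k : ℤ, (-1 : ℝ) ^ k * Real.exp (-Real.pi * (k : ℝ) ^ 2 * s)

open Real in
lemma th_summable1 (c a : ℕ → ℝ) (hc : ∀ n, |c n| ≤ 1) (ha : ∀ n : ℕ, (n : ℝ) ≤ a n) {t : ℝ}
    (ht : 0 < t) : Summable (fun n => c n * exp (-(a n * t))) := by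
  have h0 : Summable (fun n : ℕ => exp (n * (-t))) := Real.summable_exp_nat_mul_iff.2 (by linarith)
  refine Summable.of_norm_bounded h0 (fun n => ?_)
  rw [norm_mul, Real.norm_eq_abs, Real.norm_eq_abs, abs_exp]
  calc |c n| * exp (-(a n * t)) ≤ 1 * exp (-(a n * t)) := by gcongr; exact hc n
    _ ≤ exp (n * (-t)) := by
      rw [one_mul]; apply exp_le_exp.2; nlinarith [ha n]

open Real in
lemma th_bound (a t : ℝ) (ht : 0 < t) :
    a * exp (-(a * t)) ≤ 2 / t * exp (-(a * (t / 2))) := by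
  have h1 : a * t / 2 ≤ exp (a * (t / 2)) := by
    have := add_one_le_exp (a * (t / 2)); linarith
  have h2 : exp (-(a * t)) = exp (-(a * (t / 2))) * exp (-(a * (t / 2))) := by
    rw [← exp_add]; congr 1; ring
  have h3 : exp (a * (t / 2)) * exp (-(a * (t / 2))) = 1 := by rw [← exp_add]; simp
  have h4 := exp_pos (-(a * (t / 2)))
  rw [h2, div_mul_eq_mul_div, le_div_iff₀ ht]
  nlinarith [mul_le_mul_of_nonneg_right h1 (mul_pos h4 h4).le]

open Real in
lemma th_summable2 (c a : ℕ → ℝ) (hc : ∀ n, |c n| ≤ 1) (ha : ∀ n : ℕ, (n : ℝ) ≤ a n) {t : ℝ}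
    (ht : 0 < t) : Summable (fun n => a n * exp (-(a n * t))) ∧
      Summable (fun n => c n * a n * exp (-(a n * t))) := by
  have h0 := (th_summable1 (fun _ => 1) a (by simp) ha (half_pos ht)).mul_left (2 / t)
  have ha0 : ∀ n, 0 ≤ a n := fun n => le_trans (Nat.cast_nonneg n) (ha n)
  have h1 : Summable (fun n => a n * exp (-(a n * t))) := by
    refine Summable.of_nonneg_of_le (fun n => mul_nonneg (ha0 n) (exp_pos _).le) (fun n => ?_) h0
    rw [one_mul]; exact th_bound _ _ ht
  refine ⟨h1, Summable.of_norm_bounded h1 (fun n => ?_)⟩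
  rw [norm_mul, norm_mul, Real.norm_eq_abs, Real.norm_eq_abs, Real.norm_eq_abs, abs_exp,
    abs_of_nonneg (ha0 n)]
  have := mul_nonneg (ha0 n) (exp_pos (-(a n * t))).le
  nlinarith [hc n]

open Real in
lemma th_deriv (c a : ℕ → ℝ) (hc : ∀ n, |c n| ≤ 1) (ha : ∀ n : ℕ, (n : ℝ) ≤ a n) {t : ℝ}
    (ht : 0 < t) : HasDerivAt (fun t => ∑' n, c n * exp (-(a n * t)))
      (∑' n, -(c n * a n * exp (-(a n * t)))) t := by
  have ha0 : ∀ n, 0 ≤ a n := fun n => le_trans (Nat.cast_nonneg n) (ha n)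
  refine hasDerivAt_tsum_of_isPreconnected (t := Set.Ioi (t / 2)) (y₀ := t)
    (g' := fun n t => -(c n * a n * exp (-(a n * t))))
    (th_summable2 c a hc ha (half_pos ht)).1 isOpen_Ioi isPreconnected_Ioi ?_ ?_ ?_
    (th_summable1 c a hc ha ht) ?_
  · intro n y _
    have h : HasDerivAt (fun y : ℝ => -(a n * y)) (-(a n * 1)) y :=
      ((hasDerivAt_id y).const_mul (a n)).neg
    convert! h.exp.const_mul (c n) using 1
    ring
  · intro n y hy
    have hy' : t / 2 < y := hy
    rw [norm_neg, norm_mul, norm_mul, Real.norm_eq_abs, Real.norm_eq_abs, Real.norm_eq_abs,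
      abs_exp, abs_of_nonneg (ha0 n)]
    calc |c n| * a n * exp (-(a n * y)) ≤ 1 * a n * exp (-(a n * y)) := by
          gcongr
          · exact ha0 n
          · exact hc n
      _ ≤ a n * exp (-(a n * (t / 2))) := by
          rw [one_mul]
          have := ha0 n
          gcongr
  · simp [ht]
  · simp [ht]

lemma th_hs_congr {f g : ℕ → ℝ} {a : ℝ} (h : ∀ n, f n = g n) (hg : HasSum g a) : HasSum f a := by
  rwa [show f = g from funext h]

/-- exponents -/
noncomputable def thA (n : ℕ) : ℝ := Real.pi * ((n : ℝ) + 1) ^ 2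
noncomputable def thB (n : ℕ) : ℝ := Real.pi * ((n : ℝ) + 1 / 2) ^ 2

lemma thA_ge (n : ℕ) : (n : ℝ) ≤ thA n := by
  unfold thA
  have := Real.pi_gt_three
  have hn : (0 : ℝ) ≤ n := Nat.cast_nonneg n
  nlinarith [mul_nonneg (sub_nonneg.2 this.le) (sq_nonneg ((n : ℝ) + 1))]

lemma thB_ge (n : ℕ) : (n : ℝ) ≤ thB n := by
  unfold thB
  have := Real.pi_gt_three
  have hn : (0 : ℝ) ≤ n := Nat.cast_nonneg n
  nlinarith [mul_nonneg (sub_nonneg.2 this.le) (sq_nonneg ((n : ℝ) + 1 / 2))]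

lemma th_c (n : ℕ) : |(-1 : ℝ) ^ n| ≤ 1 := by simp

noncomputable def thS (s : ℝ) : ℝ := ∑' n : ℕ, (-1 : ℝ) ^ n * Real.exp (-(thA n * s))
noncomputable def thG (s : ℝ) : ℝ := ∑' n : ℕ, (1 : ℝ) * Real.exp (-(thB n * s))

lemma theta4_eq_S {s : ℝ} (hs : 0 < s) : theta4 s = 1 - 2 * thS s := by
  have h : HasSum (fun n : ℕ => (-1 : ℝ) ^ n * Real.exp (-(thA n * s))) (thS s) :=
    (th_summable1 _ _ th_c thA_ge hs).hasSum
  have h1 : HasSum (fun n : ℕ => (fun k : ℤ => (-1 : ℝ) ^ k * Real.exp (-Real.pi * (k : ℝ) ^ 2 * s))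
      ((n : ℤ) + 1)) (-thS s) := by
    refine th_hs_congr (fun n => ?_) h.neg
    have : (-1 : ℝ) ^ ((n : ℤ) + 1) = - (-1) ^ n := by
      rw [zpow_add₀ (by norm_num)]; simp
    simp only [this, thA]
    push_cast
    ring_nf
  have h2 : HasSum (fun n : ℕ => (fun k : ℤ => (-1 : ℝ) ^ k * Real.exp (-Real.pi * (k : ℝ) ^ 2 * s))
      (-((n : ℤ) + 1))) (-thS s) := by
    refine th_hs_congr (fun n => ?_) h1
    have : (-1 : ℝ) ^ (-((n : ℤ) + 1)) = (-1) ^ ((n : ℤ) + 1) := by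
      rw [zpow_neg, ← inv_zpow]; norm_num
    simp only [this]
    push_cast
    ring_nf
  have h3 := HasSum.of_add_one_of_neg_add_one
    (f := fun k : ℤ => (-1 : ℝ) ^ k * Real.exp (-Real.pi * (k : ℝ) ^ 2 * s)) h1 h2
  unfold theta4
  rw [h3.tsum_eq]
  simp
  ring

open HurwitzZeta in
lemma theta4_eq_G {s : ℝ} (hs : 0 < s) : theta4 s = s⁻¹ ^ (1 / 2 : ℝ) * (2 * thG s⁻¹) := by
  have hi : 0 < s⁻¹ := inv_pos.2 hs
  have hE : evenKernel ((1 / 2 : ℝ) : UnitAddCircle) s⁻¹ = 2 * thG s⁻¹ := by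
    have h : HasSum (fun n : ℕ => (1 : ℝ) * Real.exp (-(thB n * s⁻¹))) (thG s⁻¹) :=
      (th_summable1 (fun _ => 1) _ (by simp) thB_ge hi).hasSum
    have h1 : HasSum (fun n : ℕ => (fun k : ℤ => Real.exp (-Real.pi * ((k : ℝ) + (1 / 2 : ℝ)) ^ 2 * s⁻¹))
        (n : ℤ)) (thG s⁻¹) := by
      refine th_hs_congr (fun n => ?_) h
      simp only [thB]
      push_cast
      ring_nf
    have h2 : HasSum (fun n : ℕ => (fun k : ℤ => Real.exp (-Real.pi * ((k : ℝ) + (1 / 2 : ℝ)) ^ 2 * s⁻¹))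
        (-((n : ℤ) + 1))) (thG s⁻¹) := by
      refine th_hs_congr (fun n => ?_) h1
      push_cast
      ring_nf
    have h3 := HasSum.of_nat_of_neg_add_one
      (f := fun k : ℤ => Real.exp (-Real.pi * ((k : ℝ) + (1 / 2 : ℝ)) ^ 2 * s⁻¹)) h1 h2
    rw [(hasSum_int_evenKernel (1 / 2 : ℝ) hi).unique h3]
    ring
  have hC : cosKernel ((1 / 2 : ℝ) : UnitAddCircle) s = theta4 s := by
    have h := (hasSum_nat_cosKernel₀ (1 / 2 : ℝ) hs).tsum_eq
    have h1 : ∀ n : ℕ, 2 * Real.cos (2 * Real.pi * (1 / 2 : ℝ) * (n + 1)) *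
        Real.exp (-Real.pi * (n + 1) ^ 2 * s) = (-2) * ((-1 : ℝ) ^ n * Real.exp (-(thA n * s))) := by
      intro n
      have : 2 * Real.pi * (1 / 2 : ℝ) * (n + 1) = (n : ℝ) * Real.pi + Real.pi := by ring
      rw [this, Real.cos_add_pi, Real.cos_nat_mul_pi, thA]
      ring_nf
    simp_rw [h1] at h
    rw [tsum_mul_left] at h
    rw [theta4_eq_S hs]
    unfold thS
    linarith
  have hF := evenKernel_functional_equation ((1 / 2 : ℝ) : UnitAddCircle) s⁻¹
  rw [one_div s⁻¹, inv_inv, hC, hE] at hF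
  rw [hF]
  have : (s⁻¹ : ℝ) ^ (1 / 2 : ℝ) ≠ 0 := (Real.rpow_pos_of_pos hi _).ne'
  field_simp

lemma thG_pos {t : ℝ} (ht : 0 < t) : 0 < thG t :=
  (th_summable1 (fun _ => 1) _ (by simp) thB_ge ht).tsum_pos
    (fun n => by positivity) 0 (by positivity)

lemma theta4_pos {s : ℝ} (hs : 0 < s) : 0 < theta4 s := by
  rw [theta4_eq_G hs]
  have := thG_pos (inv_pos.2 hs)
  have : 0 < s⁻¹ ^ (1 / 2 : ℝ) := Real.rpow_pos_of_pos (inv_pos.2 hs) _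
  positivity

/-! Region `s ≥ 1` -/

noncomputable def thD (s : ℝ) : ℝ := ∑' n : ℕ, (-1 : ℝ) ^ n * thA n * Real.exp (-(thA n * s))

lemma theta4_hasDeriv {s : ℝ} (hs : 0 < s) : HasDerivAt theta4 (2 * thD s) s := by
  have h := ((th_deriv _ _ th_c thA_ge hs).const_mul 2).const_sub 1
  rw [tsum_neg] at h
  have h' : HasDerivAt (fun s => 1 - 2 * thS s) (2 * thD s) s := by
    convert! h using 1
    unfold thD; ring
  refine h'.congr_of_eventuallyEq ?_
  filter_upwards [lt_mem_nhds hs] with x hx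
  exact theta4_eq_S hx

noncomputable def thP (m : ℕ) (s : ℝ) : ℝ :=
  thA (2 * m) * s * Real.exp (-(thA (2 * m) * s)) -
    thA (2 * m + 1) * s * Real.exp (-(thA (2 * m + 1) * s))

lemma thP_hasSum {s : ℝ} (hs : 0 < s) : HasSum (fun m => thP m s) (s * thD s) := by
  have h := (th_summable2 _ _ th_c thA_ge hs).2.mul_left s
  have he : Summable (fun m : ℕ => s * ((-1 : ℝ) ^ (2 * m) * thA (2 * m) * Real.exp (-(thA (2 * m) * s)))) :=
    h.comp_injective (i := fun m : ℕ => 2 * m) (fun a b hab => by simpa using hab)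
  have ho : Summable (fun m : ℕ => s * ((-1 : ℝ) ^ (2 * m + 1) * thA (2 * m + 1) *
      Real.exp (-(thA (2 * m + 1) * s)))) :=
    h.comp_injective (i := fun m : ℕ => 2 * m + 1) (fun a b hab => by simpa using hab)
  have h2 := tsum_even_add_odd
    (f := fun n : ℕ => s * ((-1 : ℝ) ^ n * thA n * Real.exp (-(thA n * s)))) he ho
  have h3 := he.hasSum.add ho.hasSum
  rw [h2, tsum_mul_left] at h3
  change HasSum _ (s * thD s) at h3
  refine th_hs_congr (fun m => ?_) h3
  simp [thP, pow_succ, pow_mul]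
  ring

open Real in
lemma th_phi : StrictAntiOn (fun y : ℝ => y * exp (-y)) (Set.Ici 3) := by
  have hd : ∀ y : ℝ, HasDerivAt (fun y : ℝ => y * exp (-y)) ((1 - y) * exp (-y)) y := by
    intro y
    convert! (hasDerivAt_id y).mul (hasDerivAt_neg y).exp using 1
    simp; ring
  refine strictAntiOn_of_deriv_neg (convex_Ici _)
    (fun y _ => (hd y).continuousAt.continuousWithinAt) (fun y hy => ?_)
  rw [interior_Ici] at hy
  have : (3 : ℝ) < y := hy
  rw [(hd y).deriv]
  exact mul_neg_of_neg_of_pos (by linarith) (exp_pos _)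

open Real in
lemma th_psi : StrictMonoOn (fun y : ℝ => (y - y ^ 2) * exp (-y)) (Set.Ici 3) := by
  have hd : ∀ y : ℝ, HasDerivAt (fun y : ℝ => (y - y ^ 2) * exp (-y))
      ((1 - 3 * y + y ^ 2) * exp (-y)) y := by
    intro y
    convert! ((hasDerivAt_id y).sub (hasDerivAt_pow 2 y)).mul (hasDerivAt_neg y).exp using 1
    simp; ring
  refine strictMonoOn_of_deriv_pos (convex_Ici _)
    (fun y _ => (hd y).continuousAt.continuousWithinAt) (fun y hy => ?_)
  rw [interior_Ici] at hy
  have : (3 : ℝ) < y := hy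
  rw [(hd y).deriv]
  exact mul_pos (by nlinarith) (exp_pos _)

lemma thA_three (n : ℕ) : 3 ≤ thA n := by
  unfold thA
  have := Real.pi_gt_three
  have hn : (0 : ℝ) ≤ n := Nat.cast_nonneg n
  nlinarith [mul_nonneg (sub_nonneg.2 this.le) (sq_nonneg ((n : ℝ) + 1))]

lemma thA_lt (n : ℕ) : thA n < thA (n + 1) := by
  unfold thA
  push_cast
  gcongr
  linarith

lemma thA_mem (n : ℕ) {s : ℝ} (hs : 1 ≤ s) : thA n * s ∈ Set.Ici (3 : ℝ) := by
  have := thA_three n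
  simp only [Set.mem_Ici]
  nlinarith

lemma thP_nonneg (m : ℕ) {s : ℝ} (hs : 1 ≤ s) : 0 ≤ thP m s := by
  have := th_phi (thA_mem (2 * m) hs) (thA_mem (2 * m + 1) hs)
    (mul_lt_mul_of_pos_right (thA_lt _) (by linarith))
  simp only at this
  unfold thP
  linarith

open Real in
lemma thP_anti (m : ℕ) : StrictAntiOn (thP m) (Set.Ici 1) := by
  have hd1 : ∀ a s : ℝ, HasDerivAt (fun s : ℝ => a * s * exp (-(a * s)))
      ((a - a * (a * s)) * exp (-(a * s))) s := by
    intro a s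
    have h : HasDerivAt (fun y : ℝ => (a * y)) (a * 1) s := (hasDerivAt_id s).const_mul a
    convert! h.mul h.neg.exp using 1
    simp; ring
  have hd := fun s => (hd1 (thA (2 * m)) s).sub (hd1 (thA (2 * m + 1)) s)
  refine strictAntiOn_of_deriv_neg (convex_Ici _)
    (fun y _ => (hd y).continuousAt.continuousWithinAt) (fun s hs => ?_)
  rw [interior_Ici] at hs
  have hs : (1 : ℝ) < s := hs
  have h0 : 0 < s := by linarith
  have := th_psi (thA_mem (2 * m) hs.le) (thA_mem (2 * m + 1) hs.le)
    (mul_lt_mul_of_pos_right (thA_lt _) h0)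
  simp only at this
  have h1 := (hd s).deriv
  change deriv (thP m) s = _ at h1
  rw [h1]
  refine neg_of_mul_neg_right (a := s) ?_ h0.le
  nlinarith

lemma thsD_nonneg {s : ℝ} (hs : 1 ≤ s) : 0 ≤ s * thD s :=
  (thP_hasSum (by linarith)).nonneg (fun m => thP_nonneg m hs)

lemma thsD_anti : StrictAntiOn (fun s => s * thD s) (Set.Ici 1) := by
  intro s hs t ht hst
  have hs' : (1 : ℝ) ≤ s := hs
  have ht' : (1 : ℝ) ≤ t := ht
  exact hasSum_lt (i := 0) (fun m => (thP_anti m hs ht hst).le) (thP_anti 0 hs ht hst)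
    (thP_hasSum (by linarith)) (thP_hasSum (by linarith))

lemma theta4_mono : MonotoneOn theta4 (Set.Ici 1) := by
  refine monotoneOn_of_deriv_nonneg (convex_Ici _) ?_ ?_ ?_
  · intro s hs
    have hs' : (1 : ℝ) ≤ s := hs
    exact (theta4_hasDeriv (by linarith)).continuousAt.continuousWithinAt
  · intro s hs
    rw [interior_Ici] at hs
    have hs' : (1 : ℝ) < s := hs
    exact (theta4_hasDeriv (by linarith)).differentiableAt.differentiableWithinAt
  · intro s hs
    rw [interior_Ici] at hs
    have hs' : (1 : ℝ) < s := hs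
    rw [(theta4_hasDeriv (by linarith)).deriv]
    have := thsD_nonneg hs'.le
    have : 0 ≤ thD s := nonneg_of_mul_nonneg_right this (by linarith)
    linarith

lemma th_right : StrictAntiOn (fun s : ℝ => s * deriv theta4 s / theta4 s) (Set.Ici 1) := by
  intro s hs t ht hst
  have hs' : (1 : ℝ) ≤ s := hs
  have ht' : (1 : ℝ) ≤ t := ht
  have h1 := thsD_anti hs ht hst
  simp only at h1 ⊢
  rw [(theta4_hasDeriv (by linarith : 0 < s)).deriv, (theta4_hasDeriv (by linarith : 0 < t)).deriv]
  have hp := theta4_pos (by linarith : 0 < s)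
  have hm := theta4_mono hs ht hst.le
  have h2 := thsD_nonneg ht'
  calc t * (2 * thD t) / theta4 t ≤ t * (2 * thD t) / theta4 s := by
        apply div_le_div_of_nonneg_left _ hp hm
        linarith
    _ < s * (2 * thD s) / theta4 s := by
        apply div_lt_div_of_pos_right _ hp
        linarith

/-! Region `s ≤ 1` -/

noncomputable def thM (t : ℝ) : ℝ := ∑' n : ℕ, (1 : ℝ) * thB n * Real.exp (-(thB n * t))

lemma thG_hasDeriv {t : ℝ} (ht : 0 < t) : HasDerivAt thG (-thM t) t := by
  have h := th_deriv (fun _ => 1) _ (by simp) thB_ge ht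
  rw [tsum_neg] at h
  exact h

lemma theta4_logderiv {s : ℝ} (hs : 0 < s) :
    s * deriv theta4 s / theta4 s = -(1 / 2) + s⁻¹ * thM s⁻¹ / thG s⁻¹ := by
  have hi : 0 < s⁻¹ := inv_pos.2 hs
  have h1 : HasDerivAt (fun t : ℝ => t ^ (1 / 2 : ℝ) * (2 * thG t))
      (((1 / 2 : ℝ) * s⁻¹ ^ ((1 / 2 : ℝ) - 1)) * (2 * thG s⁻¹) +
        s⁻¹ ^ (1 / 2 : ℝ) * (2 * (-thM s⁻¹))) s⁻¹ :=
    (Real.hasDerivAt_rpow_const (Or.inl hi.ne')).mul ((thG_hasDeriv hi).const_mul 2)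
  have h2 := h1.comp s (hasDerivAt_inv hs.ne')
  have h3 : HasDerivAt theta4 _ s := h2.congr_of_eventuallyEq (by
    filter_upwards [lt_mem_nhds hs] with x hx
    exact theta4_eq_G hx)
  rw [h3.deriv, theta4_eq_G hs, Real.rpow_sub_one hi.ne']
  have hr : 0 < s⁻¹ ^ (1 / 2 : ℝ) := Real.rpow_pos_of_pos hi _
  have hG := thG_pos hi
  generalize s⁻¹ ^ (1 / 2 : ℝ) = r at *
  generalize thG s⁻¹ = g at *
  generalize thM s⁻¹ = m at *
  field_simp
  ring

noncomputable def thX (n : ℕ) : ℝ := Real.pi * ((n : ℝ) * (n + 1))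
noncomputable def thL (t : ℝ) : ℝ := ∑' n : ℕ, Real.exp (-(thX n * t))
noncomputable def thK (t : ℝ) : ℝ := ∑' n : ℕ, t * (thB n * Real.exp (-(thX n * t)))

lemma thX_exp (n : ℕ) (t : ℝ) :
    Real.exp (-(thX n * t)) = Real.exp (Real.pi / 4 * t) * Real.exp (-(thB n * t)) := by
  rw [← Real.exp_add]
  congr 1
  unfold thX thB
  ring

lemma thL_sum {t : ℝ} (ht : 0 < t) :
    HasSum (fun n => Real.exp (-(thX n * t))) (Real.exp (Real.pi / 4 * t) * thG t) := by
  have h := (th_summable1 (fun _ => 1) _ (by simp) thB_ge ht).hasSum.mul_left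
    (Real.exp (Real.pi / 4 * t))
  convert! h using 1
  ext n
  rw [thX_exp, one_mul]

lemma thK_sum {t : ℝ} (ht : 0 < t) :
    HasSum (fun n => t * (thB n * Real.exp (-(thX n * t))))
      (Real.exp (Real.pi / 4 * t) * (t * thM t)) := by
  have h := ((th_summable2 (fun _ => 1) _ (by simp) thB_ge ht).2.hasSum.mul_left t).mul_left
    (Real.exp (Real.pi / 4 * t))
  convert! h using 1
  ext n
  rw [thX_exp]
  ring

lemma th_telescope : HasSum (fun n : ℕ => 1 / (((n : ℝ) + 1) * (n + 2))) 1 := by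
  rw [hasSum_iff_tendsto_nat_of_nonneg (fun n => by positivity)]
  have h : ∀ n : ℕ, ∑ i ∈ Finset.range n, 1 / (((i : ℝ) + 1) * (i + 2)) = 1 - 1 / ((n : ℝ) + 1) := by
    intro n
    induction n with
    | zero => simp
    | succ k ih =>
      rw [Finset.sum_range_succ, ih]
      push_cast
      field_simp
      ring
  simp_rw [h]
  simpa using tendsto_one_div_add_atTop_nhds_zero_nat.const_sub (1 : ℝ)

open Real in
lemma th_cube {y : ℝ} (hy : 0 ≤ y) : y ^ 3 * exp (-y) ≤ 1.5 := by
  have h1 : y / 3 ≤ exp (y / 3 - 1) := by have := add_one_le_exp (y / 3 - 1); linarith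
  have h2 : (y / 3) ^ 3 ≤ exp (y / 3 - 1) ^ 3 := by gcongr
  have h3 : exp (y / 3 - 1) ^ 3 = exp y * exp (-1) ^ 3 := by
    rw [← exp_nat_mul, ← exp_nat_mul, ← exp_add]; congr 1; push_cast; ring
  have h4 : exp (-1) < 0.37 := by have := exp_neg_one_lt_d9; linarith
  have h5 : exp (-1) ^ 3 ≤ 0.37 ^ 3 := by gcongr
  have h6 : exp y * exp (-y) = 1 := by rw [← exp_add]; simp
  have h7 : y ^ 3 ≤ 1.5 * exp y := by
    rw [h3] at h2
    have := mul_le_mul_of_nonneg_left h5 (exp_pos y).le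
    have := exp_pos y
    nlinarith
  calc y ^ 3 * exp (-y) ≤ 1.5 * exp y * exp (-y) := by gcongr
    _ = 1.5 := by rw [mul_assoc, h6, mul_one]

noncomputable def thQ (n : ℕ) (t : ℝ) : ℝ :=
  t * (Real.pi / 4) * (1 / (((n : ℝ) + 1) * (n + 2))) +
    t * (thB (n + 1) * Real.exp (-(thX (n + 1) * t)))

open Real in
lemma thQ_mono (n : ℕ) : StrictMonoOn (thQ n) (Set.Ici 1) := by
  have hd : ∀ t, HasDerivAt (thQ n) (π / 4 * (1 / (((n : ℝ) + 1) * (n + 2))) +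
      thB (n + 1) * ((1 - thX (n + 1) * t) * exp (-(thX (n + 1) * t)))) t := by
    intro t
    have h : HasDerivAt (fun y : ℝ => (thX (n + 1) * y)) (thX (n + 1) * 1) t :=
      (hasDerivAt_id t).const_mul _
    convert! (((hasDerivAt_id t).mul_const (π / 4)).mul_const (1 / (((n : ℝ) + 1) * (n + 2)))).add
      ((hasDerivAt_id t).mul (h.neg.exp.const_mul (thB (n + 1)))) using 1
    simp; ring
  refine strictMonoOn_of_deriv_pos (convex_Ici _)
    (fun y _ => (hd y).continuousAt.continuousWithinAt) (fun t ht => ?_)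
  rw [interior_Ici] at ht
  have ht : (1 : ℝ) < t := ht
  rw [(hd t).deriv]
  have hpi := pi_gt_three
  have hn : (0 : ℝ) ≤ n := Nat.cast_nonneg n
  have hX : thX (n + 1) = π * (((n : ℝ) + 1) * (n + 2)) := by
    unfold thX; push_cast; ring
  have hB : thB (n + 1) = thX (n + 1) + π / 4 := by
    unfold thB thX; push_cast; ring
  set m : ℝ := ((n : ℝ) + 1) * (n + 2) with hm
  have hm2 : 2 ≤ m := by nlinarith
  set X := thX (n + 1) with hXd
  have hX6 : 6 ≤ X := by rw [hX]; nlinarith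
  have hBle : thB (n + 1) ≤ 9 / 8 * X := by rw [hB, hX]; nlinarith
  have hB0 : 0 ≤ thB (n + 1) := by rw [hB]; linarith
  set y := X * t with hy
  have hXy : X ≤ y := by nlinarith
  have hc := th_cube (y := y) (by linarith)
  have he := exp_pos (-y)
  have hm1 : 1 / m = π / X := by rw [hX]; field_simp
  rw [hm1]
  have key : thB (n + 1) * (y - 1) * exp (-y) * X < π / 4 * π := by
    calc thB (n + 1) * (y - 1) * exp (-y) * X ≤ (9 / 8 * X) * y * exp (-y) * X := by
          gcongr <;> linarith
      _ ≤ (9 / 8 * y) * y * exp (-y) * y := by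
          gcongr <;> linarith
      _ = 9 / 8 * (y ^ 3 * exp (-y)) := by ring
      _ ≤ 9 / 8 * 1.5 := by gcongr
      _ < π / 4 * π := by nlinarith
  have hX0 : 0 < X := by linarith
  have h2 : thB (n + 1) * (y - 1) * exp (-y) < π / 4 * (π / X) := by
    rw [← mul_div_assoc, lt_div_iff₀ hX0]; exact key
  nlinarith

lemma thQ_sum {t : ℝ} (ht : 0 < t) :
    HasSum (fun n => thQ n t) (Real.exp (Real.pi / 4 * t) * (t * thM t)) := by
  have h := thK_sum ht
  rw [← hasSum_nat_add_iff' 1] at h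
  have h2 := (th_telescope.mul_left (t * (Real.pi / 4))).add h
  convert! h2 using 1
  simp [thB, thX]
  ring

lemma th_h_mono : StrictMonoOn (fun t => t * thM t / thG t) (Set.Ici 1) := by
  intro s hs t ht hst
  have hs' : (1 : ℝ) ≤ s := hs
  have ht' : (1 : ℝ) ≤ t := ht
  have hs0 : 0 < s := by linarith
  have ht0 : 0 < t := by linarith
  have h1 : Real.exp (Real.pi / 4 * s) * (s * thM s) < Real.exp (Real.pi / 4 * t) * (t * thM t) :=
    hasSum_lt (i := 0) (fun m => (thQ_mono m hs ht hst).le) (thQ_mono 0 hs ht hst)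
      (thQ_sum hs0) (thQ_sum ht0)
  have hX : ∀ n, 0 ≤ thX n := fun n => by unfold thX; positivity
  have h2 : Real.exp (Real.pi / 4 * t) * thG t ≤ Real.exp (Real.pi / 4 * s) * thG s :=
    hasSum_le (fun n => by
      apply Real.exp_le_exp.2
      have := mul_le_mul_of_nonneg_left hst.le (hX n)
      linarith) (thL_sum ht0) (thL_sum hs0)
  have hB : ∀ n, 0 ≤ thB n := fun n => by unfold thB; positivity
  have h3 : 0 ≤ Real.exp (Real.pi / 4 * s) * (s * thM s) :=
    (thK_sum hs0).nonneg (fun n => by have := hB n; positivity)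
  have hg : 0 < Real.exp (Real.pi / 4 * t) * thG t := mul_pos (Real.exp_pos _) (thG_pos ht0)
  have hr : ∀ x, x * thM x / thG x =
      Real.exp (Real.pi / 4 * x) * (x * thM x) / (Real.exp (Real.pi / 4 * x) * thG x) := fun x => by
    rw [mul_div_mul_left _ _ (Real.exp_pos _).ne']
  simp only
  rw [hr s, hr t]
  exact (div_le_div_of_nonneg_left h3 hg h2).trans_lt (div_lt_div_of_pos_right h1 hg)

lemma th_left : StrictAntiOn (fun s : ℝ => s * deriv theta4 s / theta4 s) (Set.Ioc 0 1) := by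
  intro s hs t ht hst
  simp only
  rw [theta4_logderiv hs.1, theta4_logderiv ht.1]
  have h := th_h_mono (a := t⁻¹) (b := s⁻¹) ((one_le_inv₀ ht.1).2 ht.2)
    ((one_le_inv₀ hs.1).2 hs.2) (inv_strictAnti₀ hs.1 hst)
  simp only at h
  linarith

theorem theta4_log_deriv_strictAnti :
    StrictAntiOn (fun s : ℝ => s * deriv theta4 s / theta4 s) (Set.Ioi 0) := by
  have h := th_left.union th_right (c := 1) ⟨⟨one_pos, le_refl _⟩, fun x hx => hx.2⟩
    ⟨Set.self_mem_Ici, fun x hx => hx⟩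
  rwa [Set.Ioc_union_Ici_eq_Ioi one_pos] at h
end

section
/- The function s ↦ s · θ₃'(s)/θ₃(s) is strictly increasing on the interval [1, ∞). -/
noncomputable def theta3 (s : ℝ) : ℝ := ∑' k : ℤ, Real.exp (-Real.pi * (k : ℝ) ^ 2 * s)

open Real in
theorem aux_summable (s : ℝ) (hs : 0 < s) (j : ℕ) :
    Summable (fun k : ℤ => |(k:ℝ)| ^ j * Real.exp (-Real.pi * (k:ℝ)^2 * s)) := by
  have h := summable_pow_mul_jacobiTheta₂_term_bound 0 hs j
  refine h.congr fun k => ?_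
  push_cast
  congr 2
  ring

noncomputable def auxN (s : ℝ) : ℝ := ∑' k : ℤ, (k:ℝ)^2 * Real.exp (-Real.pi * (k:ℝ)^2 * s)

theorem aux_summable2 (s : ℝ) (hs : 0 < s) :
    Summable (fun k : ℤ => (k:ℝ) ^ 2 * Real.exp (-Real.pi * (k:ℝ)^2 * s)) := by
  simpa using aux_summable s hs 2

theorem aux_summable0 (s : ℝ) (hs : 0 < s) :
    Summable (fun k : ℤ => Real.exp (-Real.pi * (k:ℝ)^2 * s)) := by
  simpa using aux_summable s hs 0

theorem aux_deriv (s : ℝ) (hs : 1 ≤ s) : deriv theta3 s = -Real.pi * auxN s := by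
  have key : HasDerivAt (fun x : ℝ => ∑' k : ℤ, Real.exp (-Real.pi * (k : ℝ) ^ 2 * x))
      (∑' k : ℤ, (-Real.pi * (k:ℝ)^2) * Real.exp (-Real.pi * (k:ℝ)^2 * s)) s := by
    refine hasDerivAt_tsum_of_isPreconnected (t := Set.Ioi (1/2 : ℝ)) (y₀ := 1)
      (g := fun (k : ℤ) (x : ℝ) => Real.exp (-Real.pi * (k : ℝ) ^ 2 * x))
      (g' := fun (k : ℤ) (x : ℝ) => (-Real.pi * (k:ℝ)^2) * Real.exp (-Real.pi * (k:ℝ)^2 * x))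
      (u := fun k : ℤ => Real.pi * ((k:ℝ)^2 * Real.exp (-Real.pi * (k:ℝ)^2 * (1/2))))
      ((aux_summable2 (1/2) (by norm_num)).mul_left _) isOpen_Ioi isPreconnected_Ioi
      ?_ ?_ (by norm_num) (aux_summable0 1 one_pos) (by simp only [Set.mem_Ioi]; linarith)
    · intro k y _
      have := ((hasDerivAt_id y).const_mul (-Real.pi * (k:ℝ)^2)).exp
      simp only [id, mul_one] at this
      exact this.congr_deriv (mul_comm _ _)
    · intro k y hy
      have hy' : 1/2 < y := hy
      rw [norm_mul, Real.norm_eq_abs, Real.norm_eq_abs, Real.abs_exp, neg_mul, abs_neg,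
        abs_of_nonneg (by positivity), mul_assoc]
      have h0 : 0 ≤ Real.pi * (k:ℝ)^2 := by positivity
      refine mul_le_mul_of_nonneg_left (mul_le_mul_of_nonneg_left
        (Real.exp_le_exp.2 ?_) (sq_nonneg _)) Real.pi_pos.le
      nlinarith
  have h2 := key.deriv
  have h3 : theta3 = (fun x : ℝ => ∑' k : ℤ, Real.exp (-Real.pi * (k : ℝ) ^ 2 * x)) := rfl
  rw [h3, h2, auxN, ← tsum_mul_left]
  congr 1; ext k; ring

theorem aux_one_le (s : ℝ) (hs : 0 < s) : 1 ≤ theta3 s := by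
  have := (aux_summable0 s hs).le_tsum (0:ℤ) (fun k _ => (Real.exp_pos _).le)
  simpa [theta3] using this

theorem aux_pos (s : ℝ) (hs : 0 < s) : 0 < auxN s := by
  have := (aux_summable2 s hs).le_tsum (1:ℤ) (fun k _ => by positivity)
  refine lt_of_lt_of_le ?_ this
  simp only [Int.cast_one]
  positivity

theorem aux_decay (s t : ℝ) (hs : 0 < s) (h : s ≤ t) :
    auxN t ≤ Real.exp (-Real.pi * (t - s)) * auxN s := by
  rw [auxN, auxN, ← tsum_mul_left]
  refine (aux_summable2 t (by linarith)).tsum_le_tsum ?_ ((aux_summable2 s hs).mul_left _)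
  intro k
  by_cases hk : k = 0
  · simp [hk]
  have hk1 : (1:ℝ) ≤ (k:ℝ)^2 := by
    have : (1:ℤ) ≤ k^2 := by have := sq_pos_of_ne_zero hk; omega
    exact_mod_cast this
  rw [mul_left_comm, ← Real.exp_add]
  gcongr
  have : 0 ≤ Real.pi * (t - s) * ((k:ℝ)^2 - 1) :=
    mul_nonneg (mul_nonneg Real.pi_pos.le (by linarith)) (by linarith)
  nlinarith

theorem aux_exp : Real.exp (-Real.pi) ≤ 1/16 := by
  have h1 : (16:ℝ) ≤ Real.exp Real.pi := by
    have h2 : Real.exp 3 ≤ Real.exp Real.pi := Real.exp_le_exp.2 Real.pi_gt_three.le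
    have h3 : Real.exp 3 = Real.exp 1 ^ 3 := by rw [← Real.exp_nat_mul]; norm_num
    have h4 := Real.exp_one_gt_d9
    have h5 : (2.7:ℝ)^3 ≤ Real.exp 1 ^ 3 := by gcongr; linarith
    norm_num at h5
    linarith
  rw [Real.exp_neg, ← one_div]
  gcongr

theorem aux_term (n : ℕ) : ((n:ℝ)+1)^2 * Real.exp (-Real.pi * ((n:ℝ)+1)^2 * 1) ≤ 1/8 * (1/8)^n := by
  have e : Real.exp (-Real.pi * ((n:ℝ)+1)^2 * 1) = Real.exp (-Real.pi) ^ ((n+1)^2) := by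
    rw [← Real.exp_nat_mul]; push_cast; congr 1; ring
  rw [e]
  have h1 : Real.exp (-Real.pi) ^ ((n+1)^2) ≤ (1/16)^((n+1)^2) :=
    pow_le_pow_left₀ (Real.exp_pos _).le aux_exp _
  have h2 : ((n:ℝ)+1)^2 ≤ 2^((n+1)^2) := by
    exact_mod_cast (Nat.lt_two_pow_self (n := (n+1)^2)).le
  calc ((n:ℝ)+1)^2 * Real.exp (-Real.pi) ^ ((n+1)^2)
      ≤ 2^((n+1)^2) * (1/16)^((n+1)^2) := by gcongr
    _ = (1/8)^((n+1)^2) := by rw [← mul_pow]; norm_num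
    _ ≤ (1/8)^(n+1) := pow_le_pow_of_le_one (by norm_num) (by norm_num) (by nlinarith)
    _ = 1/8 * (1/8)^n := by ring

theorem aux_N1 : auxN 1 ≤ 1/2 := by
  have hg : HasSum (fun n : ℕ => (1/8:ℝ) * (1/8)^n) (1/7) := by
    have := (hasSum_geometric_of_lt_one (r := (1/8:ℝ)) (by norm_num) (by norm_num)).mul_left (1/8)
    norm_num at this ⊢
    exact this
  have hs : Summable (fun n : ℕ => ((n:ℝ)+1)^2 * Real.exp (-Real.pi * ((n:ℝ)+1)^2 * 1)) :=
    Summable.of_nonneg_of_le (fun n => by positivity) aux_term hg.summable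
  have hle := hasSum_le aux_term hs.hasSum hg
  have hz := HasSum.of_add_one_of_neg_add_one
    (f := fun k : ℤ => (k:ℝ)^2 * Real.exp (-Real.pi * (k:ℝ)^2 * 1))
    (m := ∑' n : ℕ, ((n:ℝ)+1)^2 * Real.exp (-Real.pi * ((n:ℝ)+1)^2 * 1))
    (m' := ∑' n : ℕ, ((n:ℝ)+1)^2 * Real.exp (-Real.pi * ((n:ℝ)+1)^2 * 1))
    (by convert hs.hasSum using 2 with n; push_cast; rfl)
    (by convert hs.hasSum using 2 with n; push_cast; rw [neg_sq])
  rw [auxN, hz.tsum_eq]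
  simp only [Int.cast_zero]
  norm_num at hle ⊢
  linarith

theorem aux_theta (s t : ℝ) (hs : 1 ≤ s) (h : s ≤ t) :
    theta3 s ≤ theta3 t * Real.exp (Real.pi / 2 * (t - s)) := by
  have h1 : theta3 s ≤ theta3 t + Real.pi * (t - s) * auxN s := by
    rw [theta3, theta3, auxN, ← tsum_mul_left,
      ← (aux_summable0 t (by linarith)).tsum_add ((aux_summable2 s (by linarith)).mul_left _)]
    refine (aux_summable0 s (by linarith)).tsum_le_tsum ?_
      ((aux_summable0 t (by linarith)).add ((aux_summable2 s (by linarith)).mul_left _))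
    intro k
    have e : Real.exp (-Real.pi * (k:ℝ)^2 * t) =
        Real.exp (-Real.pi * (k:ℝ)^2 * s) * Real.exp (-Real.pi * (k:ℝ)^2 * (t-s)) := by
      rw [← Real.exp_add]; congr 1; ring
    rw [e]
    have h2 := Real.add_one_le_exp (-Real.pi * (k:ℝ)^2 * (t-s))
    have h3 := Real.exp_pos (-Real.pi * (k:ℝ)^2 * s)
    nlinarith
  have h2 : auxN s ≤ 1/2 := by
    have a := aux_decay 1 s one_pos hs
    have b : Real.exp (-Real.pi * (s - 1)) ≤ 1 := by
      rw [Real.exp_le_one_iff]; nlinarith [Real.pi_pos]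
    nlinarith [aux_N1, aux_pos 1 one_pos]
  have h3 := aux_one_le t (by linarith)
  have h4 := Real.add_one_le_exp (Real.pi / 2 * (t - s))
  have h5 : 0 ≤ Real.pi * (t - s) := mul_nonneg Real.pi_pos.le (by linarith)
  nlinarith [mul_le_mul_of_nonneg_left h2 h5]

theorem theta3_log_deriv_strictMono_Ici_one :
    StrictMonoOn (fun s : ℝ => s * deriv theta3 s / theta3 s) (Set.Ici 1) := by
  intro s hs t ht hst
  have hs : 1 ≤ s := hs
  have ht : 1 ≤ t := ht
  have ps := aux_one_le s (by linarith)
  have pt := aux_one_le t (by linarith)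
  have ns := aux_pos s (by linarith)
  simp only [aux_deriv s hs, aux_deriv t ht]
  rw [div_lt_div_iff₀ (by linarith) (by linarith)]
  suffices h : t * auxN t * theta3 s < s * auxN s * theta3 t by
    nlinarith [mul_lt_mul_of_pos_left h Real.pi_pos]
  have h1 : t < s * Real.exp (Real.pi / 2 * (t - s)) := by
    have h4 := Real.add_one_le_exp (Real.pi / 2 * (t - s))
    have h5 : 1 * (t - s) < Real.pi / 2 * (t - s) :=
      mul_lt_mul_of_pos_right (by linarith [Real.pi_gt_three]) (by linarith)
    nlinarith
  calc t * auxN t * theta3 s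
      ≤ t * (Real.exp (-Real.pi * (t - s)) * auxN s) *
        (theta3 t * Real.exp (Real.pi / 2 * (t - s))) := by
        gcongr
        · exact aux_decay s t (by linarith) hst.le
        · exact aux_theta s t hs hst.le
    _ = t * (auxN s * theta3 t * Real.exp (-(Real.pi / 2 * (t - s)))) := by
        have : Real.exp (-(Real.pi / 2 * (t - s))) =
          Real.exp (-Real.pi * (t - s)) * Real.exp (Real.pi / 2 * (t - s)) := by
          rw [← Real.exp_add]; congr 1; ring
        rw [this]; ring
    _ < s * Real.exp (Real.pi / 2 * (t - s)) *
        (auxN s * theta3 t * Real.exp (-(Real.pi / 2 * (t - s)))) := by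
        gcongr
    _ = s * auxN s * theta3 t := by
        rw [Real.exp_neg]
        field_simp
end
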